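/- For every n ≥ 0 and all real numbers x, y, s: Σ_{π ∈ S_{n+1}} x^{basc(π)} y^{des(π)} s^{suc(π)} = Σ_{σ ∈ SS_n} (s+y)^{fix(σ)} (2xy)^{exc(σ)} (x+y)^{n − fix(σ) − 2·exc(σ)}. In particular, the coefficient γ_{n,i,j} in the expansion A_{n+1}(x,y,s) = Σ_i (s+y)^i Σ_j γ_{n,i,j} (2xy)^j (x+y)^{n−i−2j} equals the number of simsun permutations of the second kind of [n] with i fixed points and j excedances. -/

import Mathlib

open Finset

namespace SucEuler

/-- One-line notation word of a permutation: `word π i` is the value (in `1..n`)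
at position `i ∈ {1,…,n}`, and `0` for positions outside `{1,…,n}`
(this implements the conventions `π(0)=π(n+1)=0`). -/
def word {n : ℕ} (π : Equiv.Perm (Fin n)) (i : ℕ) : ℕ :=
  if h : 1 ≤ i ∧ i ≤ n then ((π ⟨i - 1, by omega⟩ : Fin n) : ℕ) + 1 else 0

/-- number of descents -/
def des {n : ℕ} (π : Equiv.Perm (Fin n)) : ℕ :=
  ((Finset.Icc 1 (n - 1)).filter fun i => word π (i + 1) < word π i).card

/-- number of ascents -/
def asc {n : ℕ} (π : Equiv.Perm (Fin n)) : ℕ :=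
  ((Finset.Icc 1 (n - 1)).filter fun i => word π i < word π (i + 1)).card

/-- number of successions -/
def suc {n : ℕ} (π : Equiv.Perm (Fin n)) : ℕ :=
  ((Finset.Icc 1 (n - 1)).filter fun i => word π (i + 1) = word π i + 1).card

/-- number of big ascents -/
def basc {n : ℕ} (π : Equiv.Perm (Fin n)) : ℕ :=
  ((Finset.Icc 1 (n - 1)).filter fun i => word π i + 2 ≤ word π (i + 1)).card

/-- number of excedances -/
def excStat {n : ℕ} (σ : Equiv.Perm (Fin n)) : ℕ :=
  (Finset.univ.filter fun i : Fin n => i < σ i).card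

/-- number of fixed points -/
def fixStat {n : ℕ} (σ : Equiv.Perm (Fin n)) : ℕ :=
  (Finset.univ.filter fun i : Fin n => σ i = i).card

/-- number of drops -/
def dropStat {n : ℕ} (σ : Equiv.Perm (Fin n)) : ℕ :=
  (Finset.univ.filter fun i : Fin n => σ i < i).card

/-- number of excedances at positions `i ≥ 2` -/
def excHat {n : ℕ} (σ : Equiv.Perm (Fin n)) : ℕ :=
  (Finset.univ.filter fun i : Fin n => 0 < (i : ℕ) ∧ i < σ i).card

/-- number of fixed points other than `1` -/
def fixHat {n : ℕ} (σ : Equiv.Perm (Fin n)) : ℕ :=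
  (Finset.univ.filter fun i : Fin n => 0 < (i : ℕ) ∧ σ i = i).card

/-- number of cycles (orbits) of a permutation -/
def cyc {n : ℕ} (σ : Equiv.Perm (Fin n)) : ℕ :=
  σ.cycleType.card + fixStat σ

/-- number of cycle double ascents: values `x` with `σ⁻¹(x) < x < σ(x)` -/
def cda {n : ℕ} (σ : Equiv.Perm (Fin n)) : ℕ :=
  (Finset.univ.filter fun x : Fin n => σ⁻¹ x < x ∧ x < σ x).card

open Classical in
/-- number of left-to-right minima -/
noncomputable def lrmin {n : ℕ} (π : Equiv.Perm (Fin n)) : ℕ :=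
  ((Finset.Icc 1 n).filter fun i => ∀ j ∈ Finset.Icc 1 n, j < i → word π i < word π j).card

open Classical in
/-- number of proper left-to-right minima -/
noncomputable def plrmin {n : ℕ} (π : Equiv.Perm (Fin n)) : ℕ :=
  ((Finset.Icc 1 n).filter fun i =>
    (∀ j ∈ Finset.Icc 1 n, j < i → word π i < word π j) ∧ word π i ≠ 1 ∧
      ∃ k ∈ Finset.Icc 1 n, i < k ∧ word π k = word π i - 1 ∧ word π (k + 1) < word π k).card

open Classical in
/-- number of simsun successions -/
noncomputable def simsuc {n : ℕ} (π : Equiv.Perm (Fin n)) : ℕ :=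
  ((Finset.Icc 1 n).filter fun i =>
    ∃ j ∈ Finset.Icc 1 n, i < j ∧ word π j = word π i + 1 ∧
      ∀ k ∈ Finset.Icc 1 n, i < k → k < j → word π i + 1 < word π k).card

/-- number of peaks (with the boundary conventions `π(0)=π(n+1)=0`) -/
def pk {n : ℕ} (π : Equiv.Perm (Fin n)) : ℕ :=
  ((Finset.Icc 1 n).filter fun i => word π (i - 1) < word π i ∧ word π (i + 1) < word π i).card

/-- number of valleys -/
def valStat {n : ℕ} (π : Equiv.Perm (Fin n)) : ℕ :=
  ((Finset.Icc 1 n).filter fun i => word π i < word π (i - 1) ∧ word π i < word π (i + 1)).card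

/-- number of double ascents -/
def dasc {n : ℕ} (π : Equiv.Perm (Fin n)) : ℕ :=
  ((Finset.Icc 1 n).filter fun i => word π (i - 1) < word π i ∧ word π i < word π (i + 1)).card

/-- number of double descents -/
def ddes {n : ℕ} (π : Equiv.Perm (Fin n)) : ℕ :=
  ((Finset.Icc 1 n).filter fun i => word π (i + 1) < word π i ∧ word π i < word π (i - 1)).card

open Classical in
/-- `nextVal σ m x` is the (0-indexed) first value `≤ m` (i.e. `< m` in 0-indexed terms)
in the forward orbit of `x` under `σ`: it equals `σ^t(x)` for the minimal `t ≥ 1`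
with `σ^t(x) < m`, when such `t` exists. This is the action of the permutation `σ_k`
(with `m = n - k`) obtained by removing the `k` largest letters from the cycles of `σ`. -/
noncomputable def nextVal {n : ℕ} (σ : Equiv.Perm (Fin n)) (m : ℕ) (x : Fin n) : ℕ :=
  if h : ∃ t : ℕ, 0 < t ∧ (((σ ^ t) x : Fin n) : ℕ) < m then (((σ ^ Nat.find h) x : Fin n) : ℕ)
  else 0

/-- `σ` is a simsun permutation of the second kind: for every `0 ≤ k ≤ n-1`, the
permutation of `[n-k]` obtained from `σ` by removing the `k` largest letters has
no cycle double ascents. (Here `m = n - k` and values are 0-indexed.) -/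
def IsSimsun2 {n : ℕ} (σ : Equiv.Perm (Fin n)) : Prop :=
  ∀ m ≤ n, ∀ x : Fin n, (x : ℕ) < m →
    ¬ (nextVal σ⁻¹ m x < (x : ℕ) ∧ (x : ℕ) < nextVal σ m x)

noncomputable instance {n : ℕ} : DecidablePred (IsSimsun2 (n := n)) :=
  fun _ => Classical.propDecidable _

/-- the derangement polynomial `d_n(x)` -/
def dpoly (n : ℕ) (x : ℝ) : ℝ :=
  ∑ σ ∈ Finset.univ.filter fun σ : Equiv.Perm (Fin n) => fixStat σ = 0, x ^ excStat σ

/-- the Eulerian polynomial `A_n(x)` -/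
def eulerian (n : ℕ) (x : ℝ) : ℝ :=
  ∑ π : Equiv.Perm (Fin n), x ^ des π


/-- insertion of the maximum at position `p` -/
def ins {n : ℕ} (p : Fin (n+1)) (π : Equiv.Perm (Fin n)) : Equiv.Perm (Fin (n+1)) :=
  (finSuccEquiv' p).trans ((Equiv.optionCongr π).trans (finSuccEquiv' (Fin.last n)).symm)

lemma ins_self {n : ℕ} (p : Fin (n+1)) (π : Equiv.Perm (Fin n)) : ins p π p = Fin.last n := by
  simp [ins]

lemma ins_succAbove {n : ℕ} (p : Fin (n+1)) (π : Equiv.Perm (Fin n)) (i : Fin n) :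
    ins p π (p.succAbove i) = (π i).castSucc := by
  simp [ins]

lemma card_aux (n : ℕ) : Fintype.card (Fin (n+1) × Equiv.Perm (Fin n)) =
    Fintype.card (Equiv.Perm (Fin (n+1))) := by
  simp [Fintype.card_perm, Nat.factorial_succ]

lemma ins_bij (n : ℕ) : Function.Bijective
    (fun q : Fin (n+1) × Equiv.Perm (Fin n) => ins q.1 q.2) := by
  rw [Fintype.bijective_iff_injective_and_card]
  refine ⟨?_, card_aux n⟩
  rintro ⟨p, π⟩ ⟨q, ρ⟩ h
  simp only at h
  have hpq : p = q := by
    have h1 := ins_self p π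
    rw [h, ← ins_self q ρ] at h1
    exact (ins q ρ).injective h1
  subst hpq
  congr 1
  ext i
  have := congrArg (fun f => f (p.succAbove i)) h
  simp only [ins_succAbove] at this
  simpa using congrArg Fin.val this

lemma word_of {n : ℕ} (π : Equiv.Perm (Fin n)) (i : Fin n) : word π (i.val + 1) = (π i).val + 1 := by
  unfold word
  rw [dif_pos (by omega)]
  simp

lemma word_top {n : ℕ} (π : Equiv.Perm (Fin n)) (i : ℕ) (h : n < i) : word π i = 0 := by
  unfold word
  rw [dif_neg (by omega)]

lemma word_ins_lt {n : ℕ} (p : Fin (n+1)) (π : Equiv.Perm (Fin n)) (i : ℕ) (h : i ≤ p.val) :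
    word (ins p π) i = word π i := by
  rcases i with _ | i
  · simp [word]
  · have hi : i < n := by omega
    have h1 := ins_succAbove p π ⟨i, hi⟩
    rw [Fin.succAbove_of_castSucc_lt _ _ (by simp [Fin.lt_def]; omega)] at h1
    have h2 := word_of (ins p π) (Fin.castSucc ⟨i, hi⟩)
    have h3 := word_of π ⟨i, hi⟩
    rw [h1] at h2
    simp at h2 h3
    omega

lemma word_ins_eq {n : ℕ} (p : Fin (n+1)) (π : Equiv.Perm (Fin n)) :
    word (ins p π) (p.val + 1) = n + 1 := by
  rw [word_of, ins_self]; simp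

lemma word_ins_gt {n : ℕ} (p : Fin (n+1)) (π : Equiv.Perm (Fin n)) (i : ℕ) (h : p.val < i) :
    word (ins p π) (i + 1) = word π i := by
  by_cases hin : i ≤ n
  · obtain ⟨i, rfl⟩ : ∃ j, i = j + 1 := ⟨i - 1, by omega⟩
    have hi : i < n := by omega
    have h1 := ins_succAbove p π ⟨i, hi⟩
    rw [Fin.succAbove_of_le_castSucc _ _ (by simp [Fin.le_def]; omega)] at h1
    have h2 := word_of (ins p π) (Fin.succ ⟨i, hi⟩)
    have h3 := word_of π ⟨i, hi⟩
    rw [h1] at h2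
    simp at h2 h3
    omega
  · rw [word_top _ _ (by omega), word_top _ _ (by omega)]

lemma word_inj {n : ℕ} (π : Equiv.Perm (Fin n)) {i j : ℕ} (hi : i < n) (hj : j < n)
    (h : word π (i+1) = word π (j+1)) : i = j := by
  have h1 := word_of π ⟨i, hi⟩
  have h2 := word_of π ⟨j, hj⟩
  simp only at h1 h2
  have : π ⟨i, hi⟩ = π ⟨j, hj⟩ := by apply Fin.ext; omega
  simpa using π.injective this

lemma word_le {n : ℕ} (π : Equiv.Perm (Fin n)) (i : ℕ) : word π i ≤ n := by
  unfold word; split_ifs <;> omega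

lemma word_pos {n : ℕ} (π : Equiv.Perm (Fin n)) {i : ℕ} (hi : i < n) : 1 ≤ word π (i+1) := by
  have := word_of π ⟨i, hi⟩
  simp only at this; omega

/-- generic counting statistic, including the final pair -/
def cnt (R : ℕ → ℕ → Prop) [DecidableRel R] (w : ℕ → ℕ) (L : ℕ) : ℕ :=
  ∑ i ∈ Finset.range L, if R (w (i+1)) (w (i+2)) then 1 else 0

section
variable (R : ℕ → ℕ → Prop) [DecidableRel R]

lemma cnt_ins_zero {n : ℕ} (π : Equiv.Perm (Fin n)) :
    cnt R (word (ins 0 π)) (n+1) = cnt R (word π) n + if R (n+1) (word π 1) then 1 else 0 := by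
  unfold cnt
  rw [Finset.sum_range_succ']
  have h0 := word_ins_eq 0 π
  have h1 := word_ins_gt 0 π 1 (by simp)
  simp at h0 h1
  simp only [zero_add, h0, h1]
  congr 1
  apply Finset.sum_congr rfl
  intro i _
  rw [word_ins_gt 0 π (i+1) (by simp), word_ins_gt 0 π (i+2) (by simp)]

lemma cnt_ins_succ {n : ℕ} (π : Equiv.Perm (Fin n)) (j : Fin n) :
    cnt R (word (ins j.succ π)) (n+1) + (if R (word π (j+1)) (word π (j+2)) then 1 else 0)
     = cnt R (word π) n + (if R (word π (j+1)) (n+1) then 1 else 0)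
       + if R (n+1) (word π (j+2)) then 1 else 0 := by
  unfold cnt
  obtain ⟨k, hk⟩ : ∃ k, n = (j.val + 1) + k := ⟨n - (j+1), by omega⟩
  have e1 : n + 1 = (j.val + 1 + 1) + k := by omega
  have w0 := word_ins_eq j.succ π
  have w1 := word_ins_lt j.succ π (j+1) (by simp)
  have w2 := word_ins_gt j.succ π (j+2) (by simp)
  have a1 : ∀ f : ℕ → ℕ, ∑ i ∈ Finset.range (n+1), f i = ∑ i ∈ Finset.range j, f i + f j + f (j+1) + ∑ i ∈ Finset.range k, f (j+1+1+i) := by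
    intro f; rw [e1, Finset.sum_range_add, Finset.sum_range_succ, Finset.sum_range_succ]
  have a2 : ∀ f : ℕ → ℕ, ∑ i ∈ Finset.range n, f i = ∑ i ∈ Finset.range j, f i + f j + ∑ i ∈ Finset.range k, f (j+1+i) := by
    intro f
    conv_lhs => rw [hk]
    rw [Finset.sum_range_add, Finset.sum_range_succ]
  rw [a1, a2]
  simp only [Fin.val_succ] at w0 w1 w2
  have s1 : ∑ i ∈ Finset.range j, (if R (word (ins j.succ π) (i+1)) (word (ins j.succ π) (i+2)) then 1 else 0) = ∑ i ∈ Finset.range j, (if R (word π (i+1)) (word π (i+2)) then 1 else 0) := by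
    apply Finset.sum_congr rfl
    intro i hi
    simp at hi
    rw [word_ins_lt _ _ _ (by simp <;> omega), word_ins_lt _ _ _ (by simp <;> omega)]
  have s2 : ∑ i ∈ Finset.range k, (if R (word (ins j.succ π) (j+1+1+i+1)) (word (ins j.succ π) (j+1+1+i+2)) then 1 else 0) = ∑ i ∈ Finset.range k, (if R (word π (j+1+i+1)) (word π (j+1+i+2)) then 1 else 0) := by
    apply Finset.sum_congr rfl
    intro i hi
    have b1 := word_ins_gt j.succ π (j+1+i+1) (by simp <;> omega)
    have b2 := word_ins_gt j.succ π (j+1+i+2) (by simp <;> omega)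
    rw [show (j:ℕ)+1+1+i+1 = j+1+i+1+1 by ring, show (j:ℕ)+1+1+i+2 = j+1+i+2+1 by ring, b1, b2]
  rw [s1, s2]
  have w0' : word (ins j.succ π) (j+2) = n+1 := w0
  have w0'' : word (ins j.succ π) (j+1+1) = n+1 := w0
  have w2' : word (ins j.succ π) (j+1+2) = word π (j+2) := w2
  rw [w0', w1, w2']
  ring

lemma cnt_Icc {n : ℕ} (π : Equiv.Perm (Fin (n+1))) :
    cnt R (word π) (n+1) = ((Finset.Icc 1 (n+1-1)).filter fun i => R (word π i) (word π (i + 1))).card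
      + if R (word π (n+1)) 0 then 1 else 0 := by
  unfold cnt
  rw [Finset.sum_range_succ, word_top π (n+2) (by omega), Finset.card_filter]
  congr 1
  rw [show Finset.Icc 1 (n+1-1) = Finset.Ico 1 (n+1) by ext; simp <;> omega, Finset.sum_Ico_eq_sum_range]
  apply Finset.sum_congr (by simp)
  intro i _
  rw [add_comm 1 i]
end

lemma cnt_des {n : ℕ} (π : Equiv.Perm (Fin (n+1))) :
    cnt (fun a b => b < a) (word π) (n+1) = des π + 1 := by
  rw [cnt_Icc, if_pos (show 0 < word π (n+1) from word_pos π (by omega))]; rfl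
lemma cnt_suc {n : ℕ} (π : Equiv.Perm (Fin (n+1))) :
    cnt (fun a b => b = a + 1) (word π) (n+1) = suc π := by
  rw [cnt_Icc, if_neg (by omega)]; rfl
lemma cnt_basc {n : ℕ} (π : Equiv.Perm (Fin (n+1))) :
    cnt (fun a b => a + 2 ≤ b) (word π) (n+1) = basc π := by
  rw [cnt_Icc, if_neg (by omega)]; rfl

open MvPolynomial in
/-- the derivation -/
noncomputable def E : Derivation ℝ (MvPolynomial (Fin 3) ℝ) (MvPolynomial (Fin 3) ℝ) :=
  MvPolynomial.mkDerivation ℝ (fun _ => X 0 * X 1)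

noncomputable abbrev xx : MvPolynomial (Fin 3) ℝ := MvPolynomial.X 0
noncomputable abbrev yy : MvPolynomial (Fin 3) ℝ := MvPolynomial.X 1
noncomputable abbrev ss : MvPolynomial (Fin 3) ℝ := MvPolynomial.X 2

lemma Ex : E xx = xx * yy := by simp [E, xx, yy, MvPolynomial.mkDerivation_X]
lemma Ey : E yy = xx * yy := by simp [E, xx, yy, MvPolynomial.mkDerivation_X]
lemma Es : E ss = xx * yy := by simp [E, xx, yy, MvPolynomial.mkDerivation_X]

/-- weight -/
noncomputable def wt {n : ℕ} (π : Equiv.Perm (Fin n)) : MvPolynomial (Fin 3) ℝ :=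
  xx ^ basc π * yy ^ des π * ss ^ suc π

lemma wt_zero {n : ℕ} (π : Equiv.Perm (Fin (n+1))) : wt (ins 0 π) = yy * wt π := by
  have h1 := cnt_ins_zero (fun a b => b < a) π
  have h2 := cnt_ins_zero (fun a b => b = a+1) π
  have h3 := cnt_ins_zero (fun a b => a + 2 ≤ b) π
  have hl := word_le π 1
  rw [cnt_des, cnt_des, if_pos (by omega)] at h1
  rw [cnt_suc, cnt_suc, if_neg (by omega)] at h2
  rw [cnt_basc, cnt_basc, if_neg (by omega)] at h3
  have h1' : des (ins 0 π) = des π + 1 := by omega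
  unfold wt
  rw [h1', h2, h3]
  ring

lemma wt_succ {n : ℕ} (π : Equiv.Perm (Fin (n+1))) (j : Fin (n+1)) : wt (ins j.succ π) =
    (if word π (j+1) = n+1 then (ss - xx) * wt π else 0)
    + (if word π (j+2) < word π (j+1) then xx * wt π else 0)
    + (if word π (j+2) = word π (j+1) + 1 then
        xx ^ (basc π + 1) * yy ^ (des π + 1) * ss ^ (suc π - 1) else 0)
    + (if word π (j+1) + 2 ≤ word π (j+2) then yy * wt π else 0) := by
  have h1 := cnt_ins_succ (fun a b => b < a) π j
  have h2 := cnt_ins_succ (fun a b => b = a+1) π j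
  have h3 := cnt_ins_succ (fun a b => a + 2 ≤ b) π j
  have l1 := word_le π (j+1)
  have l2 := word_le π (j+2)
  have l3 := word_pos π j.isLt
  have l4 : word π (j+1) ≠ word π (j+2) := by
    by_cases hj : j.val + 1 < n+1
    · intro h
      have := word_inj π j.isLt hj h
      omega
    · rw [word_top π (j+2) (by omega)]; omega
  rw [cnt_des, cnt_des] at h1
  rw [cnt_suc, cnt_suc] at h2
  rw [cnt_basc, cnt_basc] at h3
  unfold wt
  generalize word π (j+1) = a at *
  generalize word π (j+2) = b at *
  rcases lt_trichotomy b a with hb | hb | hb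
  · by_cases ha : a = n+1
    · have e1 : des (ins j.succ π) = des π := by split_ifs at h1 <;> omega
      have e2 : suc (ins j.succ π) = suc π + 1 := by split_ifs at h2 <;> omega
      have e3 : basc (ins j.succ π) = basc π := by split_ifs at h3 <;> omega
      rw [e1, e2, e3, if_pos ha, if_pos hb, if_neg (by omega), if_neg (by omega)]
      ring
    · have e1 : des (ins j.succ π) = des π := by split_ifs at h1 <;> omega
      have e2 : suc (ins j.succ π) = suc π := by split_ifs at h2 <;> omega
      have e3 : basc (ins j.succ π) = basc π + 1 := by split_ifs at h3 <;> omega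
      rw [e1, e2, e3, if_neg ha, if_pos hb, if_neg (by omega), if_neg (by omega)]
      ring
  · omega
  · by_cases hs : b = a + 1
    · have e1 : des (ins j.succ π) = des π + 1 := by split_ifs at h1 <;> omega
      have e2 : suc (ins j.succ π) = suc π - 1 := by split_ifs at h2 <;> omega
      have e3 : basc (ins j.succ π) = basc π + 1 := by split_ifs at h3 <;> omega
      rw [e1, e2, e3, if_neg (by omega), if_neg (by omega), if_pos hs, if_neg (by omega)]
      ring
    · have e1 : des (ins j.succ π) = des π + 1 := by split_ifs at h1 <;> omega
      have e2 : suc (ins j.succ π) = suc π := by split_ifs at h2 <;> omega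
      have e3 : basc (ins j.succ π) = basc π := by split_ifs at h3 <;> omega
      rw [e1, e2, e3, if_neg (by omega), if_neg (by omega), if_neg hs, if_pos (by omega)]
      ring

lemma sum_ite_cnt (R : ℕ → ℕ → Prop) [DecidableRel R] {n : ℕ} (π : Equiv.Perm (Fin n))
    (c : MvPolynomial (Fin 3) ℝ) :
    ∑ j : Fin n, (if R (word π (j+1)) (word π (j+2)) then c else 0) = cnt R (word π) n * c := by
  rw [← Finset.sum_range (fun j => if R (word π (j+1)) (word π (j+2)) then c else 0)]
  unfold cnt
  push_cast
  rw [Finset.sum_mul]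
  apply Finset.sum_congr rfl
  intros; split_ifs <;> simp

lemma sum_max {n : ℕ} (π : Equiv.Perm (Fin (n+1))) (c : MvPolynomial (Fin 3) ℝ) :
    ∑ j : Fin (n+1), (if word π (j+1) = n+1 then c else 0) = c := by
  rw [Finset.sum_eq_single (π.symm (Fin.last n))]
  · rw [word_of]; simp
  · intro j _ hj
    rw [word_of, if_neg]
    intro h
    apply hj
    rw [Equiv.eq_symm_apply]
    apply Fin.ext; simp; omega
  · simp

lemma mul_pow_pred (a : ℕ) (x : MvPolynomial (Fin 3) ℝ) : (a : MvPolynomial (Fin 3) ℝ) * x^(a-1) * x = a * x^a := by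
  rcases a with _ | a
  · simp
  · simp [pow_succ]; ring

lemma E_mon (x y s d1 d2 d3 : MvPolynomial (Fin 3) ℝ) (hx : E x = d1) (hy : E y = d2) (hs : E s = d3) (a b c : ℕ) :
    E (x^a*y^b*s^c) = a * x^(a-1) * d1 * y^b*s^c + b * y^(b-1) * d2 * x^a*s^c
      + c * s^(c-1) * d3 * x^a * y^b := by
  simp only [Derivation.leibniz, Derivation.leibniz_pow, hx, hy, hs, smul_eq_mul, nsmul_eq_mul]
  ring

lemma A_step {n : ℕ} (π : Equiv.Perm (Fin (n+1))) :
    ∑ p : Fin (n+2), wt (ins p π) = (ss + yy) * wt π + E (wt π) := by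
  rw [Fin.sum_univ_succ, wt_zero]
  simp only [wt_succ, Finset.sum_add_distrib]
  have g1 := sum_ite_cnt (fun a b => b < a) π (xx * wt π)
  have g2 := sum_ite_cnt (fun a b => b = a+1) π (xx ^ (basc π + 1) * yy ^ (des π + 1) * ss ^ (suc π - 1))
  have g3 := sum_ite_cnt (fun a b => a + 2 ≤ b) π (yy * wt π)
  rw [sum_max, g1, g2, g3, cnt_des, cnt_suc, cnt_basc]
  unfold wt
  rw [E_mon _ _ _ _ _ _ Ex Ey Es]
  have m1 := mul_pow_pred (basc π) xx
  have m2 := mul_pow_pred (des π) yy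
  push_cast
  linear_combination (-yy ^ (des π) * ss^(suc π) * yy) * m1 - (xx ^ (basc π) * ss^(suc π) * xx) * m2

lemma A_rec (n : ℕ) : ∑ π : Equiv.Perm (Fin (n+2)), wt π =
    (ss + yy) * (∑ π : Equiv.Perm (Fin (n+1)), wt π) + E (∑ π : Equiv.Perm (Fin (n+1)), wt π) := by
  rw [map_sum, Finset.mul_sum, ← Finset.sum_add_distrib]
  simp_rw [← A_step]
  rw [Finset.sum_comm, ← Fintype.sum_prod_type']
  exact ((ins_bij (n+1)).sum_comp (fun π => wt π)).symm

/-- extension by a fixed point -/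
def ext1 {n : ℕ} (σ : Equiv.Perm (Fin n)) : Equiv.Perm (Fin (n+1)) := ins (Fin.last n) σ

/-- insertion into a cycle -/
def cins {n : ℕ} (p : Fin (n+1)) (σ : Equiv.Perm (Fin n)) : Equiv.Perm (Fin (n+1)) :=
  ext1 σ * Equiv.swap p (Fin.last n)

lemma ext1_last {n : ℕ} (σ : Equiv.Perm (Fin n)) : ext1 σ (Fin.last n) = Fin.last n := ins_self _ _

lemma ext1_cast {n : ℕ} (σ : Equiv.Perm (Fin n)) (i : Fin n) :
    ext1 σ i.castSucc = (σ i).castSucc := by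
  have := ins_succAbove (Fin.last n) σ i
  rwa [Fin.succAbove_last] at this

lemma ext1_inv {n : ℕ} (σ : Equiv.Perm (Fin n)) : (ext1 σ)⁻¹ = ext1 σ⁻¹ := by
  rw [inv_eq_iff_mul_eq_one]
  ext i
  refine Fin.lastCases ?_ (fun i => ?_) i <;> simp [ext1_last, ext1_cast]

lemma cins_p {n : ℕ} (p : Fin (n+1)) (σ : Equiv.Perm (Fin n)) : cins p σ p = Fin.last n := by
  simp [cins, ext1_last]
lemma cins_last {n : ℕ} (p : Fin (n+1)) (σ : Equiv.Perm (Fin n)) :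
    cins p σ (Fin.last n) = ext1 σ p := by
  simp [cins]
lemma cins_ne {n : ℕ} (p : Fin (n+1)) (σ : Equiv.Perm (Fin n)) (i : Fin n) (h : i.castSucc ≠ p) :
    cins p σ i.castSucc = (σ i).castSucc := by
  simp [cins, Equiv.swap_apply_of_ne_of_ne h (Fin.castSucc_ne_last i), ext1_cast]

lemma cins_inv {n : ℕ} (p : Fin (n+1)) (σ : Equiv.Perm (Fin n)) :
    (cins p σ)⁻¹ = cins (ext1 σ p) σ⁻¹ := by
  rw [inv_eq_iff_mul_eq_one]
  unfold cins
  rw [← ext1_inv]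
  have : ext1 σ * Equiv.swap p (Fin.last n) * (ext1 σ)⁻¹ = Equiv.swap (ext1 σ p) (Fin.last n) := by
    rw [← Equiv.swap_apply_apply, ext1_last]
  rw [← mul_assoc, this, Equiv.swap_mul_self]

lemma cins_bij (n : ℕ) : Function.Bijective
    (fun q : Fin (n+1) × Equiv.Perm (Fin n) => cins q.1 q.2) := by
  rw [Fintype.bijective_iff_injective_and_card]
  refine ⟨?_, card_aux n⟩
  rintro ⟨p, π⟩ ⟨q, ρ⟩ h
  simp only at h
  have hpq : p = q := by
    have h1 := cins_p p π
    rw [h, ← cins_p q ρ] at h1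
    exact (cins q ρ).injective h1
  subst hpq
  unfold cins at h
  have h2 := mul_right_cancel h
  congr 1
  ext i
  have := congrArg (fun f => f i.castSucc) h2
  simp only [ext1_cast] at this
  simpa using congrArg Fin.val this

lemma nextVal_one {n : ℕ} (σ : Equiv.Perm (Fin n)) (m : ℕ) (x : Fin n) (h : (σ x).val < m) :
    nextVal σ m x = (σ x).val := by
  have hex : ∃ t : ℕ, 0 < t ∧ (((σ ^ t) x : Fin n) : ℕ) < m := ⟨1, by simp, by simpa using h⟩
  unfold nextVal
  rw [dif_pos hex]
  have : Nat.find hex = 1 := by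
    rw [Nat.find_eq_iff]
    exact ⟨⟨by simp, by simpa using h⟩, fun k hk => by omega⟩
  rw [this, pow_one]

lemma nextVal_step {n : ℕ} (σ : Equiv.Perm (Fin n)) (m : ℕ) (x : Fin n) (h : ¬ (σ x).val < m)
    (hex : ∃ t : ℕ, 0 < t ∧ (((σ ^ t) (σ x) : Fin n) : ℕ) < m) :
    nextVal σ m x = nextVal σ m (σ x) := by
  have hs := Nat.find_spec hex
  have hm : ∀ k, k < Nat.find hex → _ := fun k hk => Nat.find_min hex hk
  have hps : ∀ t, (σ ^ (t+1)) x = (σ ^ t) (σ x) := fun t => by rw [pow_succ]; rfl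
  have hex' : ∃ t : ℕ, 0 < t ∧ (((σ ^ t) x : Fin n) : ℕ) < m :=
    ⟨Nat.find hex + 1, by omega, by rw [hps]; exact hs.2⟩
  have hf : Nat.find hex' = Nat.find hex + 1 := by
    rw [Nat.find_eq_iff]
    refine ⟨⟨by omega, by rw [hps]; exact hs.2⟩, ?_⟩
    rintro k hk ⟨h1, h2⟩
    obtain ⟨k, rfl⟩ : ∃ j, k = j + 1 := ⟨k - 1, by omega⟩
    rw [hps] at h2
    rcases Nat.eq_zero_or_pos k with rfl | h0
    · exact h (by simpa using h2)
    · exact hm k (by omega) ⟨h0, h2⟩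
  unfold nextVal
  rw [dif_pos hex', dif_pos hex, hf, hps]

/-- first return exists -/
def Ret {n : ℕ} (σ : Equiv.Perm (Fin n)) (m : ℕ) (x : Fin n) : Prop :=
  ∃ t : ℕ, 0 < t ∧ (((σ ^ t) x : Fin n) : ℕ) < m

lemma Ret_one {n : ℕ} (σ : Equiv.Perm (Fin n)) (m : ℕ) (x : Fin n) (h : (σ x).val < m) :
    Ret σ m x := ⟨1, by simp, by simpa using h⟩
lemma Ret_step {n : ℕ} (σ : Equiv.Perm (Fin n)) (m : ℕ) (x : Fin n) (h : Ret σ m (σ x)) :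
    Ret σ m x := by
  obtain ⟨t, ht, h⟩ := h
  exact ⟨t+1, by omega, by rw [pow_succ]; exact h⟩

lemma nextVal_cins_aux {n : ℕ} (p : Fin (n+1)) (σ : Equiv.Perm (Fin n)) (m : ℕ) (hm : m ≤ n) (t : ℕ) :
    ∀ x : Fin n, ((σ ^ (t+1)) x).val < m → Ret σ m x ∧ Ret (cins p σ) m x.castSucc ∧
      nextVal (cins p σ) m x.castSucc = nextVal σ m x := by
  have key : ∀ x : Fin n, (((σ x).val < m) ∨ (Ret σ m (σ x) ∧ Ret (cins p σ) m (σ x).castSucc ∧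
      nextVal (cins p σ) m (σ x).castSucc = nextVal σ m (σ x))) →
      Ret σ m x ∧ Ret (cins p σ) m x.castSucc ∧
      nextVal (cins p σ) m x.castSucc = nextVal σ m x := by
    intro x h
    by_cases h0 : (σ x).val < m
    · by_cases hp : x.castSucc = p
      · subst hp
        have e1 := cins_p x.castSucc σ
        have e2 := cins_last x.castSucc σ
        rw [ext1_cast] at e2
        have r2 : Ret (cins x.castSucc σ) m (Fin.last n) := Ret_one _ _ _ (by rw [e2]; exact h0)
        have r2' := r2
        rw [← e1] at r2'
        refine ⟨Ret_one _ _ _ h0, Ret_step _ _ _ r2', ?_⟩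
        rw [nextVal_step _ _ _ (by rw [e1]; simp; omega) r2', e1,
          nextVal_one _ _ _ (by rw [e2]; exact h0), e2, nextVal_one _ _ _ h0]
        simp
      · have e := cins_ne p σ x hp
        refine ⟨Ret_one _ _ _ h0, Ret_one _ _ _ (by rw [e]; exact h0), ?_⟩
        rw [nextVal_one _ _ _ h0, nextVal_one _ _ _ (by rw [e]; exact h0), e]
        simp
    · obtain ⟨r1, r2, r3⟩ := h.resolve_left h0
      by_cases hp : x.castSucc = p
      · subst hp
        have e1 := cins_p x.castSucc σ
        have e2 := cins_last x.castSucc σ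
        rw [ext1_cast] at e2
        rw [← e2] at r2
        have r4 := Ret_step _ _ _ r2
        have r4' := r4
        rw [← e1] at r4'
        refine ⟨Ret_step _ _ _ r1, Ret_step _ _ _ r4', ?_⟩
        rw [nextVal_step _ _ _ (by rw [e1]; simp; omega) r4', e1,
          nextVal_step _ _ _ (by rw [e2]; exact h0) r2, e2, nextVal_step _ _ _ h0 r1, r3]
      · have e := cins_ne p σ x hp
        rw [← e] at r2
        refine ⟨Ret_step _ _ _ r1, Ret_step _ _ _ r2, ?_⟩
        rw [nextVal_step _ _ _ (by rw [e]; exact h0) r2, e, nextVal_step _ _ _ h0 r1, r3]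
  induction t with
  | zero => intro x h; exact key x (Or.inl (by simpa using h))
  | succ t ih => intro x h; exact key x (Or.inr (ih (σ x) (by rw [pow_succ] at h; exact h)))

lemma nextVal_cins {n : ℕ} (p : Fin (n+1)) (σ : Equiv.Perm (Fin n)) (m : ℕ) (hm : m ≤ n)
    (x : Fin n) (hx : x.val < m) : nextVal (cins p σ) m x.castSucc = nextVal σ m x := by
  have h1 : 0 < orderOf σ := orderOf_pos σ
  refine (nextVal_cins_aux p σ m hm (orderOf σ - 1) x ?_).2.2
  rw [Nat.sub_add_cancel h1, pow_orderOf_eq_one]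
  exact hx

lemma nextVal_full {n : ℕ} (σ : Equiv.Perm (Fin n)) (x : Fin n) : nextVal σ n x = (σ x).val :=
  nextVal_one _ _ _ (σ x).isLt

/-- no cycle double ascents -/
def NoCda {n : ℕ} (σ : Equiv.Perm (Fin n)) : Prop := ∀ x, ¬ (σ⁻¹ x < x ∧ x < σ x)

lemma IsSimsun2.noCda {n : ℕ} {σ : Equiv.Perm (Fin n)} (h : IsSimsun2 σ) : NoCda σ := by
  intro x
  have := h n le_rfl x x.isLt
  rwa [nextVal_full, nextVal_full] at this

lemma simsun_cins1 {n : ℕ} (p : Fin (n+1)) (σ : Equiv.Perm (Fin n)) :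
    IsSimsun2 (cins p σ) ↔ IsSimsun2 σ ∧ NoCda (cins p σ) := by
  constructor
  · intro h
    refine ⟨?_, h.noCda⟩
    intro m hm x hx
    have := h m (by omega) x.castSucc hx
    rw [cins_inv, nextVal_cins _ _ _ hm _ hx, nextVal_cins _ _ _ hm _ hx] at this
    exact this
  · rintro ⟨h1, h2⟩ m hm x hx
    by_cases hmn : m ≤ n
    · obtain ⟨y, rfl⟩ : ∃ y : Fin n, x = y.castSucc := ⟨⟨x, by omega⟩, by ext; simp⟩
      have hx' : y.val < m := hx
      rw [cins_inv, nextVal_cins _ _ _ hmn _ hx', nextVal_cins _ _ _ hmn _ hx']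
      exact h1 m hmn y hx'
    · obtain rfl : m = n+1 := by omega
      rw [nextVal_full, nextVal_full]
      exact h2 x

lemma noCda_last {n : ℕ} (σ : Equiv.Perm (Fin n)) (h : NoCda σ) : NoCda (cins (Fin.last n) σ) := by
  intro x
  rw [cins_inv, ext1_last]
  refine Fin.lastCases ?_ (fun i => ?_) x
  · rw [cins_p]; simp
  · rw [cins_ne _ _ _ (Fin.castSucc_ne_last i), cins_ne _ _ _ (Fin.castSucc_ne_last i)]
    exact h i

lemma noCda_cast {n : ℕ} (σ : Equiv.Perm (Fin n)) (h : NoCda σ) (i : Fin n) :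
    NoCda (cins i.castSucc σ) ↔ i ≤ σ⁻¹ i := by
  have hlt : ∀ j : Fin n, j.castSucc < Fin.last n := fun j => Fin.castSucc_lt_last j
  constructor
  · intro hc
    by_contra hi
    push Not at hi
    apply hc i.castSucc
    rw [cins_inv, cins_p, ext1_cast, cins_ne]
    · exact ⟨hi, hlt i⟩
    · intro he
      have : i = σ i := by simpa using he
      rw [Equiv.Perm.inv_eq_iff_eq.mpr this] at hi
      exact lt_irrefl _ hi
  · intro hi x
    refine Fin.lastCases ?_ (fun j => ?_) x
    · rintro ⟨_, h2⟩
      exact absurd h2 (not_lt.mpr (Fin.le_last _))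
    · rw [cins_inv, ext1_cast]
      rintro ⟨h1, h2⟩
      by_cases hj : j.castSucc = (σ i).castSucc
      · rw [hj, cins_p] at h1
        exact absurd h1 (not_lt.mpr (Fin.le_last _))
      · rw [cins_ne _ _ _ hj] at h1
        have h1' : σ⁻¹ j < j := h1
        by_cases hji : j = i
        · subst hji; exact absurd h1' (not_lt.mpr hi)
        · rw [cins_ne _ _ _ (by simpa using hji)] at h2
          exact h j ⟨h1', h2⟩

lemma fix_last {n : ℕ} (σ : Equiv.Perm (Fin n)) : fixStat (cins (Fin.last n) σ) = fixStat σ + 1 := by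
  unfold fixStat
  simp only [Finset.card_filter, Fin.sum_univ_castSucc, cins_p]
  simp [cins_ne]

lemma exc_last {n : ℕ} (σ : Equiv.Perm (Fin n)) : excStat (cins (Fin.last n) σ) = excStat σ := by
  unfold excStat
  simp only [Finset.card_filter, Fin.sum_univ_castSucc, cins_p]
  simp [cins_ne]

lemma fix_cast {n : ℕ} (σ : Equiv.Perm (Fin n)) (i : Fin n) :
    fixStat (cins i.castSucc σ) + (if σ i = i then 1 else 0) = fixStat σ := by
  unfold fixStat
  simp only [Finset.card_filter, Fin.sum_univ_castSucc, cins_last, ext1_cast]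
  rw [if_neg (Fin.castSucc_ne_last _), ← Finset.add_sum_erase _ _ (Finset.mem_univ i),
    ← Finset.add_sum_erase (Finset.univ) (fun j => if σ j = j then 1 else 0) (Finset.mem_univ i),
    cins_p, if_neg (Fin.castSucc_ne_last _).symm]
  have : ∑ j ∈ Finset.univ.erase i, (if cins i.castSucc σ j.castSucc = j.castSucc then 1 else 0) =
    ∑ j ∈ Finset.univ.erase i, (if σ j = j then 1 else 0) := by
    apply Finset.sum_congr rfl
    intro j hj
    rw [cins_ne _ _ _ (by simpa using hj)]
    simp
  rw [this]; ring

lemma exc_cast {n : ℕ} (σ : Equiv.Perm (Fin n)) (i : Fin n) :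
    excStat (cins i.castSucc σ) + (if i < σ i then 1 else 0) = excStat σ + 1 := by
  unfold excStat
  simp only [Finset.card_filter, Fin.sum_univ_castSucc, cins_last, ext1_cast]
  rw [if_neg (not_lt.mpr (Fin.le_last _)), ← Finset.add_sum_erase _ _ (Finset.mem_univ i),
    ← Finset.add_sum_erase (Finset.univ) (fun j => if j < σ j then 1 else 0) (Finset.mem_univ i),
    cins_p, if_pos (Fin.castSucc_lt_last _)]
  have : ∑ j ∈ Finset.univ.erase i, (if j.castSucc < cins i.castSucc σ j.castSucc then 1 else 0) =
    ∑ j ∈ Finset.univ.erase i, (if j < σ j then 1 else 0) := by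
    apply Finset.sum_congr rfl
    intro j hj
    rw [cins_ne _ _ _ (by simpa using hj)]
    simp
  rw [this]; ring

/-- double descents of the cycles -/
def cdd {n : ℕ} (σ : Equiv.Perm (Fin n)) : ℕ :=
  (Finset.univ.filter fun i : Fin n => i < σ⁻¹ i ∧ σ i < i).card

lemma cdd_eq {n : ℕ} (σ : Equiv.Perm (Fin n)) (h : NoCda σ) :
    cdd σ + fixStat σ + 2 * excStat σ = n := by
  have h1 : ∑ i : Fin n, (if i < σ⁻¹ i then 1 else 0) = ∑ i : Fin n, (if σ i < i then 1 else 0) := by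
    rw [← Equiv.sum_comp σ (fun i => if i < σ⁻¹ i then 1 else 0)]
    simp
  have h2 : ∑ i : Fin n, ((if i < σ i then 1 else 0) + (if σ i = i then 1 else 0) + (if σ i < i then 1 else 0)) = n := by
    rw [Finset.sum_congr rfl (g := fun _ => 1)]
    · simp
    · intro i _
      rcases lt_trichotomy i (σ i) with h | h | h
      · simp [h, h.ne', h.le]
      · simp [← h]
      · simp [h, h.ne, h.le]
  have h3 : ∀ i : Fin n, (if i < σ⁻¹ i then 1 else 0) = (if i < σ⁻¹ i ∧ σ i < i then 1 else 0) + (if i < σ i then 1 else 0) := by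
    intro i
    have hi := h i
    have hf : σ⁻¹ i = i ↔ σ i = i := by
      rw [Equiv.Perm.inv_eq_iff_eq]; exact eq_comm
    rcases lt_trichotomy i (σ i) with h | h | h
    · have : i < σ⁻¹ i := by
        rcases lt_trichotomy (σ⁻¹ i) i with h' | h' | h'
        · exact absurd ⟨h', h⟩ hi
        · exact absurd (hf.mp h') h.ne'
        · exact h'
      rw [if_pos this, if_pos h, if_neg (fun h' => lt_asymm h h'.2)]
    · have := hf.mpr h.symm
      simp [this, ← h]
    · simp [h, h.le]
  simp only [h3, Finset.sum_add_distrib] at h1 h2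
  unfold cdd fixStat excStat
  simp only [Finset.card_filter]
  omega

/-- weight of the right-hand side -/
noncomputable def wr {n : ℕ} (σ : Equiv.Perm (Fin n)) : MvPolynomial (Fin 3) ℝ :=
  (ss + yy) ^ fixStat σ * (2 * xx * yy) ^ excStat σ * (xx + yy) ^ (n - fixStat σ - 2 * excStat σ)

open Classical in
lemma wr_cast {n : ℕ} (σ : Equiv.Perm (Fin n)) (h : NoCda σ) (i : Fin n) :
    (if NoCda (cins i.castSucc σ) then wr (cins i.castSucc σ) else 0) =
    (if σ i = i then (ss + yy) ^ (fixStat σ - 1) * (2 * xx * yy) ^ (excStat σ + 1) * (xx + yy) ^ cdd σ else 0)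
    + (if i < σ i then (ss + yy) ^ fixStat σ * (2 * xx * yy) ^ excStat σ * (xx + yy) ^ (cdd σ + 1) else 0)
    + (if i < σ⁻¹ i ∧ σ i < i then
        (ss + yy) ^ fixStat σ * (2 * xx * yy) ^ (excStat σ + 1) * (xx + yy) ^ (cdd σ - 1) else 0) := by
  have hf : σ⁻¹ i = i ↔ σ i = i := by
    rw [Equiv.Perm.inv_eq_iff_eq]; exact eq_comm
  have f1 := fix_cast σ i
  have f2 := exc_cast σ i
  have f3 := cdd_eq σ h
  have hi := h i
  rw [if_congr (noCda_cast σ h i) rfl rfl]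
  unfold wr
  rcases lt_trichotomy i (σ i) with h0 | h0 | h0
  · rw [if_neg h0.ne'] at f1 ⊢
    rw [if_pos h0] at f2 ⊢
    rw [if_pos (by by_contra h'; exact hi ⟨not_le.mp h', h0⟩), if_neg (fun h' => lt_asymm h0 h'.2)]
    rw [show fixStat (cins i.castSucc σ) = fixStat σ by omega,
      show excStat (cins i.castSucc σ) = excStat σ by omega,
      show n + 1 - fixStat σ - 2 * excStat σ = cdd σ + 1 by omega]
    ring
  · rw [if_pos h0.symm] at f1 ⊢
    rw [if_neg h0.not_lt] at f2 ⊢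
    rw [if_pos (hf.mpr h0.symm).ge, if_neg (fun h' => h0.not_gt h'.2)]
    rw [show fixStat (cins i.castSucc σ) = fixStat σ - 1 by omega,
      show excStat (cins i.castSucc σ) = excStat σ + 1 by omega,
      show n + 1 - (fixStat σ - 1) - 2 * (excStat σ + 1) = cdd σ by omega]
    ring
  · rw [if_neg h0.ne] at f1 ⊢
    rw [if_neg h0.le.not_gt] at f2 ⊢
    by_cases h1 : i < σ⁻¹ i
    · have hc : 0 < cdd σ := Finset.card_pos.mpr ⟨i, Finset.mem_filter.mpr ⟨Finset.mem_univ _, h1, h0⟩⟩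
      rw [if_pos h1.le, if_pos ⟨h1, h0⟩]
      rw [show fixStat (cins i.castSucc σ) = fixStat σ by omega,
        show excStat (cins i.castSucc σ) = excStat σ + 1 by omega,
        show n + 1 - fixStat σ - 2 * (excStat σ + 1) = cdd σ - 1 by omega]
      ring
    · rw [if_neg (fun h' => h1 (lt_of_le_of_ne h' (fun h'' => h0.ne (hf.mp h''.symm)))), if_neg (fun h' => h1 h'.1)]
      ring

lemma sum_ite_card {n : ℕ} (P : Fin n → Prop) [DecidablePred P] (c : MvPolynomial (Fin 3) ℝ) :
    ∑ i : Fin n, (if P i then c else 0) = ((Finset.univ.filter P).card : MvPolynomial (Fin 3) ℝ) * c := by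
  rw [← Finset.sum_filter, Finset.sum_const, nsmul_eq_mul]

lemma Eu : E (ss + yy) = 2 * xx * yy := by rw [map_add, Es, Ey]; ring
lemma Ep : E (xx + yy) = 2 * xx * yy := by rw [map_add, Ex, Ey]; ring
lemma Eq : E (2 * xx * yy) = 2 * xx * yy * (xx + yy) := by
  have : (2 * xx * yy : MvPolynomial (Fin 3) ℝ) = xx * yy + xx * yy := by ring
  rw [this, map_add, Derivation.leibniz, Ex, Ey]
  simp only [smul_eq_mul]; ring

open Classical in
lemma B_step {n : ℕ} (σ : Equiv.Perm (Fin n)) (h : NoCda σ) :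
    ∑ p : Fin (n+1), (if NoCda (cins p σ) then wr (cins p σ) else 0) =
      (ss + yy) * wr σ + E (wr σ) := by
  rw [Fin.sum_univ_castSucc, if_pos (noCda_last σ h)]
  simp only [wr_cast σ h, Finset.sum_add_distrib]
  rw [sum_ite_card, sum_ite_card, sum_ite_card]
  have f3 := cdd_eq σ h
  unfold wr
  rw [fix_last, exc_last, show n + 1 - (fixStat σ + 1) - 2 * excStat σ = cdd σ by omega,
    show n - fixStat σ - 2 * excStat σ = cdd σ by omega, E_mon _ _ _ _ _ _ Eu Eq Ep]
  have m2 := mul_pow_pred (excStat σ) (2 * xx * yy)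
  change (fixStat σ : MvPolynomial (Fin 3) ℝ) * _ + (excStat σ : MvPolynomial (Fin 3) ℝ) * _ + (cdd σ : MvPolynomial (Fin 3) ℝ) * _ + _ = _
  linear_combination (-(xx + yy) * (ss + yy) ^ fixStat σ * (xx + yy) ^ cdd σ) * m2

lemma B_rec (n : ℕ) : ∑ σ ∈ Finset.univ.filter (fun σ : Equiv.Perm (Fin (n+1)) => IsSimsun2 σ), wr σ =
    (ss + yy) * (∑ σ ∈ Finset.univ.filter (fun σ : Equiv.Perm (Fin n) => IsSimsun2 σ), wr σ)
     + E (∑ σ ∈ Finset.univ.filter (fun σ : Equiv.Perm (Fin n) => IsSimsun2 σ), wr σ) := by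
  classical
  rw [map_sum, Finset.mul_sum, ← Finset.sum_add_distrib, Finset.sum_filter, Finset.sum_filter,
    ← (cins_bij n).sum_comp (fun σ => if IsSimsun2 σ then wr σ else 0), Fintype.sum_prod_type,
    Finset.sum_comm]
  apply Finset.sum_congr rfl
  intro σ _
  by_cases hs : IsSimsun2 σ
  · rw [if_pos hs, ← B_step σ hs.noCda]
    apply Finset.sum_congr rfl
    intro p _
    simp only [simsun_cins1, hs, true_and]
  · rw [if_neg hs]
    apply Finset.sum_eq_zero
    intro p _
    simp only [simsun_cins1, hs, false_and, if_false]

lemma main_eq (n : ℕ) : ∑ π : Equiv.Perm (Fin (n+1)), wt π =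
    ∑ σ ∈ Finset.univ.filter (fun σ : Equiv.Perm (Fin n) => IsSimsun2 σ), wr σ := by
  induction n with
  | zero =>
    have : IsSimsun2 (1 : Equiv.Perm (Fin 0)) := fun m hm x => x.elim0
    rw [Finset.filter_true_of_mem (fun σ _ => by rwa [Subsingleton.elim σ 1])]
    simp [wt, wr, basc, des, suc, fixStat, excStat]
  | succ n ih => rw [A_rec, B_rec, ih]

/-- `Σ_{π ∈ S_{n+1}} x^basc y^des s^suc
= Σ_{σ ∈ SS_n} (s+y)^fix (2xy)^exc (x+y)^(n - fix - 2 exc)`. -/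
theorem statement4 (n : ℕ) (x y s : ℝ) :
    ∑ π : Equiv.Perm (Fin (n + 1)), x ^ basc π * y ^ des π * s ^ suc π =
      ∑ σ ∈ Finset.univ.filter fun σ : Equiv.Perm (Fin n) => IsSimsun2 σ,
        (s + y) ^ fixStat σ * (2 * x * y) ^ excStat σ *
          (x + y) ^ (n - fixStat σ - 2 * excStat σ) := by
  have h := congrArg (MvPolynomial.eval ![x, y, s]) (main_eq n)
  simpa [wt, wr] using h

end SucEuler
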